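/- The sequent calculi G(K4_h), G(KD4_h), and G(S4_h) enjoy cut elimination: every sequent provable in these systems has a cut-free proof. -/

import Mathlib

/-- Poly-modal formulas with modalities `□n` for `n : ℕ`. -/
inductive Fm : Type
  | atom : ℕ → Fm
  | bot  : Fm
  | and  : Fm → Fm → Fm
  | or   : Fm → Fm → Fm
  | imp  : Fm → Fm → Fm
  | neg  : Fm → Fm
  | box  : ℕ → Fm → Fm
  deriving DecidableEq

def Fm.top : Fm := Fm.neg Fm.bot

/-- `i` occurs as a modality index in the formula. -/
def occursBox (i : ℕ) : Fm → Prop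
  | .atom _ => False
  | .bot => False
  | .and A B => occursBox i A ∨ occursBox i B
  | .or A B => occursBox i A ∨ occursBox i B
  | .imp A B => occursBox i A ∨ occursBox i B
  | .neg A => occursBox i A
  | .box n A => i = n ∨ occursBox i A

/-- `n` is strictly greater than every modality index occurring in `A`
    (the paper's "`n > r(A)`"). -/
def BoxLt (A : Fm) (n : ℕ) : Prop := ∀ i, occursBox i A → i < n

/-- The language `L∞`: each box index strictly exceeds all box indices in its scope. -/
inductive Linf : Fm → Prop
  | atom (k : ℕ) : Linf (.atom k)
  | bot : Linf .bot
  | and {A B : Fm} : Linf A → Linf B → Linf (.and A B)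
  | or {A B : Fm} : Linf A → Linf B → Linf (.or A B)
  | imp {A B : Fm} : Linf A → Linf B → Linf (.imp A B)
  | neg {A : Fm} : Linf A → Linf (.neg A)
  | box {A : Fm} (n : ℕ) : Linf A → BoxLt A n → Linf (.box n A)

/-- Boolean evaluation treating atoms and boxed formulas as propositional atoms. -/
def evalWith (v : Fm → Bool) : Fm → Bool
  | .atom k => v (.atom k)
  | .bot => false
  | .and A B => evalWith v A && evalWith v B
  | .or A B => evalWith v A || evalWith v B
  | .imp A B => !(evalWith v A) || evalWith v B
  | .neg A => !(evalWith v A)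
  | .box n A => v (.box n A)

/-- Classical propositional tautologies (on `L∞`-formulas as atoms). -/
def Taut (A : Fm) : Prop := ∀ v, evalWith v A = true

def axH (F : Fm) : Prop := ∃ A n, Linf (Fm.box n A) ∧ F = (Fm.box n A).imp (Fm.box (n+1) A)
def axK (F : Fm) : Prop := ∃ A B n, Linf (Fm.box n (A.imp B)) ∧
    F = (Fm.box n (A.imp B)).imp ((Fm.box n A).imp (Fm.box n B))
def axFour (F : Fm) : Prop := ∃ A n, Linf (Fm.box n A) ∧
    F = (Fm.box n A).imp (Fm.box (n+1) (Fm.box n A))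
def axD (F : Fm) : Prop := ∃ n, F = Fm.neg (Fm.box n Fm.bot)
def axT (F : Fm) : Prop := ∃ A n, Linf (Fm.box n A) ∧ F = (Fm.box n A).imp A
def axL (F : Fm) : Prop := ∃ A n, Linf (Fm.box n A) ∧
    F = (Fm.box (n+1) ((Fm.box n A).imp A)).imp (Fm.box n A)
def axFive (F : Fm) : Prop := ∃ A n, Linf (Fm.box n A) ∧
    F = ((Fm.box n A).neg).imp (Fm.box (n+1) ((Fm.box n A).neg))

/-- Hilbert-style provability over `L∞` from a set of axiom (schema instances):
    classical tautologies, modus ponens, and necessitation restricted to `n > r(A)`. -/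
inductive Prv (Ax : Fm → Prop) : Fm → Prop
  | ax {A : Fm} : Ax A → Prv Ax A
  | taut {A : Fm} : Linf A → Taut A → Prv Ax A
  | mp {A B : Fm} : Prv Ax (A.imp B) → Prv Ax A → Prv Ax B
  | nec {A : Fm} (n : ℕ) : Prv Ax A → BoxLt A n → Prv Ax (Fm.box n A)

def K4hAx (F : Fm) : Prop := axH F ∨ axK F ∨ axFour F
def KD4hAx (F : Fm) : Prop := K4hAx F ∨ axD F
def S4hAx (F : Fm) : Prop := K4hAx F ∨ axT F
def GLhAx (F : Fm) : Prop := K4hAx F ∨ axL F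
def KD45hAx (F : Fm) : Prop := KD4hAx F ∨ axFive F

def K4h : Fm → Prop := Prv K4hAx
def KD4h : Fm → Prop := Prv KD4hAx
def S4h : Fm → Prop := Prv S4hAx
def GLh : Fm → Prop := Prv GLhAx

def conjList (l : List Fm) : Fm := l.foldr Fm.and Fm.top
def disjList (l : List Fm) : Fm := l.foldr Fm.or Fm.bot

/-- `Γ ⊢_L A` : some finite conjunction of members of `Γ` implies `A` in `L`. -/
def Deriv (Ax : Fm → Prop) (Γ : Set Fm) (A : Fm) : Prop :=
  ∃ l : List Fm, (∀ B ∈ l, B ∈ Γ) ∧ Prv Ax ((conjList l).imp A)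

inductive Sys : Type | K4 | KD4 | S4

/-- Sequent calculi `G(K4_h)`, `G(KD4_h)`, `G(S4_h)` over multisets of `L∞` formulas.
    The boolean parameter `c` allows (`true`) or forbids (`false`) the cut rule. -/
inductive GSeq (sys : Sys) (c : Bool) : Multiset Fm → Multiset Fm → Prop
  | id (A : Fm) : Linf A → GSeq sys c {A} {A}
  | botL : GSeq sys c {Fm.bot} 0
  | wL {Γ Δ} (A : Fm) : Linf A → GSeq sys c Γ Δ → GSeq sys c (A ::ₘ Γ) Δ
  | wR {Γ Δ} (A : Fm) : Linf A → GSeq sys c Γ Δ → GSeq sys c Γ (A ::ₘ Δ)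
  | cL {Γ Δ} (A : Fm) : GSeq sys c (A ::ₘ A ::ₘ Γ) Δ → GSeq sys c (A ::ₘ Γ) Δ
  | cR {Γ Δ} (A : Fm) : GSeq sys c Γ (A ::ₘ A ::ₘ Δ) → GSeq sys c Γ (A ::ₘ Δ)
  | cut {Γ₀ Δ₀ Γ₁ Δ₁} (A : Fm) : c = true →
      GSeq sys c Γ₀ (A ::ₘ Δ₀) → GSeq sys c (A ::ₘ Γ₁) Δ₁ →
      GSeq sys c (Γ₀ + Γ₁) (Δ₀ + Δ₁)
  | orL {Γ₀ Δ₀ Γ₁ Δ₁} (A B : Fm) :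
      GSeq sys c (A ::ₘ Γ₀) Δ₀ → GSeq sys c (B ::ₘ Γ₁) Δ₁ →
      GSeq sys c ((A.or B) ::ₘ (Γ₀ + Γ₁)) (Δ₀ + Δ₁)
  | orR₁ {Γ Δ} (A B : Fm) : Linf B →
      GSeq sys c Γ (A ::ₘ Δ) → GSeq sys c Γ ((A.or B) ::ₘ Δ)
  | orR₂ {Γ Δ} (A B : Fm) : Linf A →
      GSeq sys c Γ (B ::ₘ Δ) → GSeq sys c Γ ((A.or B) ::ₘ Δ)
  | andL₁ {Γ Δ} (A B : Fm) : Linf B →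
      GSeq sys c (A ::ₘ Γ) Δ → GSeq sys c ((A.and B) ::ₘ Γ) Δ
  | andL₂ {Γ Δ} (A B : Fm) : Linf A →
      GSeq sys c (B ::ₘ Γ) Δ → GSeq sys c ((A.and B) ::ₘ Γ) Δ
  | andR {Γ₀ Δ₀ Γ₁ Δ₁} (A B : Fm) :
      GSeq sys c Γ₀ (A ::ₘ Δ₀) → GSeq sys c Γ₁ (B ::ₘ Δ₁) →
      GSeq sys c (Γ₀ + Γ₁) ((A.and B) ::ₘ (Δ₀ + Δ₁))
  | impL {Γ₀ Δ₀ Γ₁ Δ₁} (A B : Fm) :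
      GSeq sys c Γ₀ (A ::ₘ Δ₀) → GSeq sys c (B ::ₘ Γ₁) Δ₁ →
      GSeq sys c ((A.imp B) ::ₘ (Γ₀ + Γ₁)) (Δ₀ + Δ₁)
  | impR {Γ Δ} (A B : Fm) :
      GSeq sys c (A ::ₘ Γ) (B ::ₘ Δ) → GSeq sys c Γ ((A.imp B) ::ₘ Δ)
  | negL {Γ Δ} (A : Fm) :
      GSeq sys c Γ (A ::ₘ Δ) → GSeq sys c ((Fm.neg A) ::ₘ Γ) Δ
  | negR {Γ Δ} (A : Fm) :
      GSeq sys c (A ::ₘ Γ) Δ → GSeq sys c Γ ((Fm.neg A) ::ₘ Δ)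
  | box4R (hs : sys = Sys.K4 ∨ sys = Sys.KD4) (n : ℕ)
      (S : List Fm) (G : List (ℕ × Fm)) (A : Fm)
      (hn : ∀ p ∈ G, p.1 < n)
      (hS : ∀ σ ∈ S, Linf (Fm.box n σ)) (hG : ∀ p ∈ G, Linf (Fm.box p.1 p.2))
      (hA : Linf (Fm.box n A)) :
      GSeq sys c (↑S + ↑(G.map Prod.snd) + ↑(G.map fun p => Fm.box p.1 p.2)) {A} →
      GSeq sys c (↑(S.map (Fm.box n)) + ↑(G.map fun p => Fm.box p.1 p.2)) {Fm.box n A}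
  | boxDR (hs : sys = Sys.KD4) (n : ℕ)
      (S : List Fm) (G : List (ℕ × Fm))
      (hn : ∀ p ∈ G, p.1 < n)
      (hS : ∀ σ ∈ S, Linf (Fm.box n σ)) (hG : ∀ p ∈ G, Linf (Fm.box p.1 p.2)) :
      GSeq sys c (↑S + ↑(G.map Prod.snd) + ↑(G.map fun p => Fm.box p.1 p.2)) 0 →
      GSeq sys c (↑(S.map (Fm.box n)) + ↑(G.map fun p => Fm.box p.1 p.2)) 0
  | boxSR (hs : sys = Sys.S4) (n : ℕ)
      (S : List Fm) (G : List (ℕ × Fm)) (A : Fm)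
      (hn : ∀ p ∈ G, p.1 < n)
      (hS : ∀ σ ∈ S, Linf (Fm.box n σ)) (hG : ∀ p ∈ G, Linf (Fm.box p.1 p.2))
      (hA : Linf (Fm.box n A)) :
      GSeq sys c (↑S + ↑(G.map fun p => Fm.box p.1 p.2)) {A} →
      GSeq sys c (↑(S.map (Fm.box n)) + ↑(G.map fun p => Fm.box p.1 p.2)) {Fm.box n A}
  | boxL (hs : sys = Sys.S4) {Γ Δ} (n : ℕ) (A : Fm) (hA : Linf (Fm.box n A)) :
      GSeq sys c (A ::ₘ Γ) Δ → GSeq sys c ((Fm.box n A) ::ₘ Γ) Δ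

section CutElimProof

theorem Linf_box_inner {n : ℕ} {A : Fm} (h : Linf (Fm.box n A)) : Linf A := by
  cases h; assumption

/-- Every formula in a provable sequent belongs to the language. -/
theorem gseq_linf {sys : Sys} {c : Bool} {Γ Δ : Multiset Fm} (h : GSeq sys c Γ Δ) :
    (∀ x ∈ Γ, Linf x) ∧ (∀ x ∈ Δ, Linf x) := by
  induction h with
  | id A hA => simp [hA]
  | botL => simp [Linf.bot]
  | wL A hA _ ih => simp_all
  | wR A hA _ ih => simp_all
  | cL A _ ih => simp_all
  | cR A _ ih => simp_all
  | cut A _ _ _ ih1 ih2 =>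
    simp only [Multiset.mem_cons, Multiset.mem_add] at *
    grind
  | orL A B _ _ ih1 ih2 =>
    simp only [Multiset.mem_cons, Multiset.mem_add] at *
    grind [Linf.or]
  | orR₁ A B hB _ ih => simp only [Multiset.mem_cons] at *; grind [Linf.or]
  | orR₂ A B hB _ ih => simp only [Multiset.mem_cons] at *; grind [Linf.or]
  | andL₁ A B hB _ ih => simp only [Multiset.mem_cons] at *; grind [Linf.and]
  | andL₂ A B hB _ ih => simp only [Multiset.mem_cons] at *; grind [Linf.and]
  | andR A B _ _ ih1 ih2 =>
    simp only [Multiset.mem_cons, Multiset.mem_add] at *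
    grind [Linf.and]
  | impL A B _ _ ih1 ih2 =>
    simp only [Multiset.mem_cons, Multiset.mem_add] at *
    grind [Linf.imp]
  | impR A B _ ih => simp only [Multiset.mem_cons] at *; grind [Linf.imp]
  | negL A _ ih => simp only [Multiset.mem_cons] at *; grind [Linf.neg]
  | negR A _ ih => simp only [Multiset.mem_cons] at *; grind [Linf.neg]
  | box4R hs n S G A hn hS hG hA _ ih =>
    simp only [Multiset.mem_add, Multiset.mem_coe, List.mem_map, Multiset.mem_singleton]
    grind
  | boxDR hs n S G hn hS hG _ ih =>
    simp only [Multiset.mem_add, Multiset.mem_coe, List.mem_map, Multiset.notMem_zero]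
    grind
  | boxSR hs n S G A hn hS hG hA _ ih =>
    simp only [Multiset.mem_add, Multiset.mem_coe, List.mem_map, Multiset.mem_singleton]
    grind
  | boxL hs n A hA _ ih => simp only [Multiset.mem_cons] at *; grind

theorem gseq_weakL {sys : Sys} {c : Bool} {Γ Δ : Multiset Fm} (h : GSeq sys c Γ Δ)
    (Θ : Multiset Fm) (hΘ : ∀ x ∈ Θ, Linf x) : GSeq sys c (Θ + Γ) Δ := by
  induction Θ using Multiset.induction_on with
  | empty => simpa using h
  | cons a s ih =>
    rw [Multiset.cons_add]
    exact GSeq.wL a (hΘ a (by simp)) (ih fun x hx => hΘ x (by simp [hx]))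

theorem gseq_weakR {sys : Sys} {c : Bool} {Γ Δ : Multiset Fm} (h : GSeq sys c Γ Δ)
    (Θ : Multiset Fm) (hΘ : ∀ x ∈ Θ, Linf x) : GSeq sys c Γ (Θ + Δ) := by
  induction Θ using Multiset.induction_on with
  | empty => simpa using h
  | cons a s ih =>
    rw [Multiset.cons_add]
    exact GSeq.wR a (hΘ a (by simp)) (ih fun x hx => hΘ x (by simp [hx]))

theorem gseq_contrL {sys : Sys} {c : Bool} {Γ Δ : Multiset Fm} (Θ : Multiset Fm)
    (hΘ : ∀ x ∈ Θ, x ∈ Γ) (h : GSeq sys c (Θ + Γ) Δ) : GSeq sys c Γ Δ := by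
  induction Θ using Multiset.induction_on with
  | empty => simpa using h
  | cons a s ih =>
    refine ih (fun x hx => hΘ x (by simp [hx])) ?_
    obtain ⟨t, rfl⟩ := Multiset.exists_cons_of_mem (hΘ a (by simp))
    rw [Multiset.add_cons]
    apply GSeq.cL
    rwa [Multiset.cons_add, Multiset.add_cons] at h

theorem gseq_contrR {sys : Sys} {c : Bool} {Γ Δ : Multiset Fm} (Θ : Multiset Fm)
    (hΘ : ∀ x ∈ Θ, x ∈ Δ) (h : GSeq sys c Γ (Θ + Δ)) : GSeq sys c Γ Δ := by
  induction Θ using Multiset.induction_on with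
  | empty => simpa using h
  | cons a s ih =>
    refine ih (fun x hx => hΘ x (by simp [hx])) ?_
    obtain ⟨t, rfl⟩ := Multiset.exists_cons_of_mem (hΘ a (by simp))
    rw [Multiset.add_cons]
    apply GSeq.cR
    rwa [Multiset.cons_add, Multiset.add_cons] at h

/-- Provability depends monotonically on the underlying sets of formulas. -/
theorem gseq_struct {sys : Sys} {c : Bool} {Γ Δ Γ' Δ' : Multiset Fm} (h : GSeq sys c Γ Δ)
    (h1 : ∀ x ∈ Γ, x ∈ Γ') (h2 : ∀ x ∈ Δ, x ∈ Δ')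
    (l1 : ∀ x ∈ Γ', Linf x) (l2 : ∀ x ∈ Δ', Linf x) : GSeq sys c Γ' Δ' := by
  apply gseq_contrL Γ h1
  apply gseq_contrR Δ h2
  rw [add_comm Γ, add_comm Δ]
  exact gseq_weakR (gseq_weakL h _ l1) _ l2

/-- Cut-free provability from a set of signed formulas. -/
def SProv (sys : Sys) (W : Set (Bool × Fm)) : Prop :=
  ∃ Γ Δ : Multiset Fm, (∀ x ∈ Γ, (true, x) ∈ W) ∧ (∀ x ∈ Δ, (false, x) ∈ W) ∧
    GSeq sys false Γ Δ

def SCons (sys : Sys) : Set (Set (Bool × Fm)) :=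
  {W | (∀ p ∈ W, Linf p.2) ∧ ¬ SProv sys W}

theorem scons_fin (sys : Sys) : Order.IsOfFiniteCharacter (SCons sys) := by
  intro W
  constructor
  · rintro ⟨h1, h2⟩ Y hY _
    refine ⟨fun p hp => h1 p (hY hp), ?_⟩
    rintro ⟨Γ, Δ, a, b, d⟩
    exact h2 ⟨Γ, Δ, fun x hx => hY (a x hx), fun x hx => hY (b x hx), d⟩
  · intro h
    refine ⟨fun p hp => (h {p} (by simpa using hp) (Set.finite_singleton p)).1 p rfl, ?_⟩
    rintro ⟨Γ, Δ, a, b, d⟩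
    let Y : Set (Bool × Fm) :=
      Set.image (fun x => (true, x)) (Γ.toFinset : Set Fm) ∪
        Set.image (fun x => (false, x)) (Δ.toFinset : Set Fm)
    have hY : Y ⊆ W := by
      rintro p (⟨x, hx, rfl⟩ | ⟨x, hx, rfl⟩)
      · exact a x (by simpa using hx)
      · exact b x (by simpa using hx)
    have hf : Y.Finite :=
      ((Finset.finite_toSet _).image _).union ((Finset.finite_toSet _).image _)
    refine (h Y hY hf).2 ⟨Γ, Δ, fun x hx => Or.inl ⟨x, by simpa using hx, rfl⟩,
      fun x hx => Or.inr ⟨x, by simpa using hx, rfl⟩, d⟩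

/-- Worlds of the canonical model: maximal cut-free-unprovable signed sets. -/
def CWorld (sys : Sys) : Type := {W : Set (Bool × Fm) // Maximal (· ∈ SCons sys) W}

def inL {sys : Sys} (w : CWorld sys) (A : Fm) : Prop := (true, A) ∈ w.1
def inR {sys : Sys} (w : CWorld sys) (A : Fm) : Prop := (false, A) ∈ w.1

variable {sys : Sys}

theorem inL_linf {w : CWorld sys} {A : Fm} (h : inL w A) : Linf A := w.2.1.1 _ h
theorem inR_linf {w : CWorld sys} {A : Fm} (h : inR w A) : Linf A := w.2.1.1 _ h

theorem world_cons (w : CWorld sys) {Γ Δ : Multiset Fm} (h1 : ∀ x ∈ Γ, inL w x)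
    (h2 : ∀ x ∈ Δ, inR w x) (h : GSeq sys false Γ Δ) : False :=
  w.2.1.2 ⟨Γ, Δ, h1, h2, h⟩

theorem not_inL {w : CWorld sys} {A : Fm} (hA : Linf A) (h : ¬ inL w A) :
    ∃ Γ Δ : Multiset Fm, (∀ x ∈ Γ, inL w x) ∧ (∀ x ∈ Δ, inR w x) ∧
      GSeq sys false (A ::ₘ Γ) Δ := by
  have h1 : SProv sys (insert (true, A) w.1) := by
    by_contra hc
    have : insert (true, A) w.1 ∈ SCons sys := by
      refine ⟨?_, hc⟩
      rintro p (rfl | hp)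
      · exact hA
      · exact w.2.1.1 p hp
    exact h (w.2.2 this (Set.subset_insert _ _) (Set.mem_insert _ _))
  obtain ⟨Γ, Δ, a, b, d⟩ := h1
  refine ⟨Γ.filter (· ≠ A), Δ, ?_, ?_, ?_⟩
  · intro x hx
    rw [Multiset.mem_filter] at hx
    rcases a x hx.1 with h | h
    · simp_all
    · exact h
  · intro x hx
    rcases b x hx with h | h
    · simp at h
    · exact h
  · have l := gseq_linf d
    refine gseq_struct d ?_ (fun x hx => hx) ?_ l.2
    · intro x hx
      simp only [Multiset.mem_cons, Multiset.mem_filter]; tauto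
    · intro x hx
      simp only [Multiset.mem_cons, Multiset.mem_filter] at hx
      rcases hx with rfl | hx
      · exact hA
      · exact l.1 x hx.1

theorem not_inR {w : CWorld sys} {A : Fm} (hA : Linf A) (h : ¬ inR w A) :
    ∃ Γ Δ : Multiset Fm, (∀ x ∈ Γ, inL w x) ∧ (∀ x ∈ Δ, inR w x) ∧
      GSeq sys false Γ (A ::ₘ Δ) := by
  have h1 : SProv sys (insert (false, A) w.1) := by
    by_contra hc
    have : insert (false, A) w.1 ∈ SCons sys := by
      refine ⟨?_, hc⟩
      rintro p (rfl | hp)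
      · exact hA
      · exact w.2.1.1 p hp
    exact h (w.2.2 this (Set.subset_insert _ _) (Set.mem_insert _ _))
  obtain ⟨Γ, Δ, a, b, d⟩ := h1
  refine ⟨Γ, Δ.filter (· ≠ A), ?_, ?_, ?_⟩
  · intro x hx
    rcases a x hx with h | h
    · simp at h
    · exact h
  · intro x hx
    rw [Multiset.mem_filter] at hx
    rcases b x hx.1 with h | h
    · simp_all
    · exact h
  · have l := gseq_linf d
    refine gseq_struct d (fun x hx => hx) ?_ l.1 ?_
    · intro x hx
      simp only [Multiset.mem_cons, Multiset.mem_filter]; tauto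
    · intro x hx
      simp only [Multiset.mem_cons, Multiset.mem_filter] at hx
      rcases hx with rfl | hx
      · exact hA
      · exact l.2 x hx.1

theorem world_exists (W : Set (Bool × Fm)) (h1 : ∀ p ∈ W, Linf p.2) (h2 : ¬ SProv sys W) :
    ∃ w : CWorld sys, W ⊆ w.1 := by
  obtain ⟨m, hm, hmax⟩ := (scons_fin sys).exists_maximal (x := W) ⟨h1, h2⟩
  exact ⟨⟨m, hmax⟩, hm⟩

/-- Canonical accessibility relations. -/
def CR (n : ℕ) (w v : CWorld sys) : Prop :=
  (∀ A, inL w (.box n A) → inL v A) ∧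
  (∀ m A, m < n → inL w (.box m A) → inL v A ∧ inL v (.box m A))

theorem CR_mono {n m : ℕ} {w v : CWorld sys} (h : CR n w v) (hm : m < n) : CR m w v :=
  ⟨fun A hA => (h.2 m A hm hA).1, fun k A hk hA => h.2 k A (hk.trans hm) hA⟩

theorem CR_trans {n m : ℕ} {w v u : CWorld sys} (h : CR n w v) (hm : m < n) (h' : CR m v u) :
    CR m w u :=
  ⟨fun A hA => h'.1 A (h.2 m A hm hA).2, fun k A hk hA => h'.2 k A hk (h.2 k A (hk.trans hm) hA).2⟩

/-- Forcing in the canonical model. -/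
def forces : Fm → CWorld sys → Prop
  | .atom k, w => inL w (.atom k)
  | .bot, _ => False
  | .and A B, w => forces A w ∧ forces B w
  | .or A B, w => forces A w ∨ forces B w
  | .imp A B, w => forces A w → forces B w
  | .neg A, w => ¬ forces A w
  | .box n A, w => ∀ v, CR n w v → forces A v

theorem inL_of_box (hs : sys = Sys.S4) {w : CWorld sys} {n : ℕ} {A : Fm}
    (h : inL w (.box n A)) : inL w A := by
  by_contra hc
  obtain ⟨Γ, Δ, a, b, d⟩ := not_inL (Linf_box_inner (inL_linf h)) hc
  refine world_cons w ?_ b (GSeq.boxL hs n A (inL_linf h) d)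
  simp only [Multiset.mem_cons]; grind

theorem CR_refl (hs : sys = Sys.S4) (n : ℕ) (w : CWorld sys) : CR n w w :=
  ⟨fun _ h => inL_of_box hs h, fun _ _ _ h => ⟨inL_of_box hs h, h⟩⟩

/-- The formulas transferred along `CR n`. -/
def desc (n : ℕ) (w : CWorld sys) (x : Fm) : Prop :=
  inL w (.box n x) ∨ ∃ m A, m < n ∧ inL w (.box m A) ∧ (x = A ∨ x = .box m A)

theorem desc_linf {n : ℕ} {w : CWorld sys} {x : Fm} (h : desc n w x) : Linf x := by
  rcases h with h | ⟨m, A, -, h, rfl | rfl⟩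
  · exact Linf_box_inner (inL_linf h)
  · exact Linf_box_inner (inL_linf h)
  · exact inL_linf h

theorem desc_lists {n : ℕ} {w : CWorld sys} (Γ : Multiset Fm) (h : ∀ x ∈ Γ, desc n w x) :
    ∃ (S : List Fm) (G : List (ℕ × Fm)), (∀ σ ∈ S, inL w (.box n σ)) ∧
      (∀ p ∈ G, p.1 < n ∧ inL w (.box p.1 p.2)) ∧
      ∀ x ∈ Γ, x ∈ S ∨ x ∈ G.map Prod.snd ∨ x ∈ G.map fun p => Fm.box p.1 p.2 := by
  induction Γ using Multiset.induction_on with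
  | empty => exact ⟨[], [], by simp, by simp, by simp⟩
  | cons a s ih =>
    obtain ⟨S, G, h1, h2, h3⟩ := ih fun x hx => h x (by simp [hx])
    rcases h a (by simp) with ha | ⟨m, A, hm, ha, hx⟩
    · refine ⟨a :: S, G, by simpa using ⟨ha, h1⟩, h2, ?_⟩
      intro x hx
      simp only [Multiset.mem_cons] at hx
      rcases hx with rfl | hx
      · simp
      · have := h3 x hx
        simp only [List.mem_cons]; tauto
    · refine ⟨S, (m, A) :: G, h1, ?_, ?_⟩
      · intro p hp
        rcases List.mem_cons.1 hp with rfl | hp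
        · exact ⟨hm, ha⟩
        · exact h2 p hp
      intro x hx'
      simp only [Multiset.mem_cons] at hx'
      simp only [List.map_cons, List.mem_cons]
      rcases hx' with rfl | hx'
      · tauto
      · have := h3 x hx'
        tauto

theorem boxL_list (hs : sys = Sys.S4) (G : List (ℕ × Fm)) (Γ Δ : Multiset Fm)
    (hG : ∀ p ∈ G, Linf (.box p.1 p.2))
    (h : GSeq sys false (↑(G.map Prod.snd) + Γ) Δ) :
    GSeq sys false (↑(G.map fun p => Fm.box p.1 p.2) + Γ) Δ := by
  induction G generalizing Γ with
  | nil => simpa using h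
  | cons p G ih =>
    have := GSeq.boxL hs p.1 p.2 (hG p (by simp)) (Γ := ↑(G.map Prod.snd) + Γ) (Δ := Δ)
      (by simpa [← Multiset.cons_coe] using h)
    have := ih (Fm.box p.1 p.2 ::ₘ Γ) (fun q hq => hG q (by simp [hq])) (by
      rw [Multiset.add_cons]; exact this)
    rw [Multiset.add_cons] at this
    simpa [← Multiset.cons_coe] using this

theorem box_witness {n : ℕ} {A : Fm} {w : CWorld sys} (h : inR w (.box n A)) :
    ∃ v, CR n w v ∧ inR v A := by
  have hA := inR_linf h
  obtain ⟨v, hv⟩ := world_exists (sys := sys)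
    {p | (p.1 = true ∧ desc n w p.2) ∨ p = (false, A)} (by
      rintro p (⟨_, hp⟩ | rfl)
      · exact desc_linf hp
      · exact Linf_box_inner hA) (by
      rintro ⟨Γ, Δ, a, b, d⟩
      have a' : ∀ x ∈ Γ, desc n w x := by
        intro x hx
        simpa using a x hx
      have b' : ∀ x ∈ Δ, x = A := by
        intro x hx
        simpa using b x hx
      obtain ⟨S, G, h1, h2, h3⟩ := desc_lists Γ a'
      have hS : ∀ σ ∈ S, Linf (Fm.box n σ) := fun σ hσ => inL_linf (h1 σ hσ)
      have hG : ∀ p ∈ G, Linf (Fm.box p.1 p.2) := fun p hp => inL_linf (h2 p hp).2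
      have d' : GSeq sys false
          (↑S + ↑(G.map Prod.snd) + ↑(G.map fun p => Fm.box p.1 p.2)) {A} := by
        refine gseq_struct d ?_ ?_ ?_ ?_
        · intro x hx
          have := h3 x hx
          simp only [Multiset.mem_add, Multiset.mem_coe]; tauto
        · intro x hx; simpa using b' x hx
        · intro x hx
          simp only [Multiset.mem_add, Multiset.mem_coe, List.mem_map] at hx
          rcases hx with (hx | ⟨p, hp, rfl⟩) | ⟨p, hp, rfl⟩
          · exact Linf_box_inner (hS x hx)
          · exact Linf_box_inner (hG p hp)
          · exact hG p hp
        · intro x hx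
          rw [Multiset.mem_singleton] at hx
          exact hx ▸ Linf_box_inner hA
      have key : GSeq sys false
          (↑(S.map (Fm.box n)) + ↑(G.map fun p => Fm.box p.1 p.2)) {Fm.box n A} := by
        rcases hsys : sys with _ | _ | _
        · rw [hsys] at d'
          exact GSeq.box4R (Or.inl rfl) n S G A (fun p hp => (h2 p hp).1) hS hG hA d'
        · rw [hsys] at d'
          exact GSeq.box4R (Or.inr rfl) n S G A (fun p hp => (h2 p hp).1) hS hG hA d'
        · rw [hsys] at d'
          refine GSeq.boxSR rfl n S G A (fun p hp => (h2 p hp).1) hS hG hA ?_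
          rw [add_comm (↑S : Multiset Fm), add_assoc] at d'
          have e := boxL_list rfl G _ _ hG d'
          refine gseq_contrL (↑(G.map fun p => Fm.box p.1 p.2)) ?_ e
          intro x hx
          exact Multiset.mem_add.2 (Or.inr hx)
      refine world_cons w ?_ ?_ key
      · intro x hx
        simp only [Multiset.mem_add, Multiset.mem_coe, List.mem_map] at hx
        rcases hx with ⟨σ, hσ, rfl⟩ | ⟨p, hp, rfl⟩
        · exact h1 σ hσ
        · exact (h2 p hp).2
      · intro x hx
        rw [Multiset.mem_singleton] at hx
        exact hx ▸ h)
  refine ⟨v, ⟨fun B hB => hv (Or.inl ⟨rfl, Or.inl hB⟩), fun m B hm hB =>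
    ⟨hv (Or.inl ⟨rfl, Or.inr ⟨m, B, hm, hB, Or.inl rfl⟩⟩),
     hv (Or.inl ⟨rfl, Or.inr ⟨m, B, hm, hB, Or.inr rfl⟩⟩)⟩⟩, hv (Or.inr rfl)⟩

theorem CR_serial (hs : sys = Sys.KD4) (n : ℕ) (w : CWorld sys) : ∃ v, CR n w v := by
  obtain ⟨v, hv⟩ := world_exists (sys := sys)
    {p | p.1 = true ∧ desc n w p.2} (by
      rintro p ⟨_, hp⟩
      exact desc_linf hp) (by
      rintro ⟨Γ, Δ, a, b, d⟩
      have a' : ∀ x ∈ Γ, desc n w x := by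
        intro x hx
        simpa using a x hx
      have b' : ∀ x ∈ Δ, False := by
        intro x hx
        simpa using b x hx
      obtain ⟨S, G, h1, h2, h3⟩ := desc_lists Γ a'
      have hS : ∀ σ ∈ S, Linf (Fm.box n σ) := fun σ hσ => inL_linf (h1 σ hσ)
      have hG : ∀ p ∈ G, Linf (Fm.box p.1 p.2) := fun p hp => inL_linf (h2 p hp).2
      have d' : GSeq sys false
          (↑S + ↑(G.map Prod.snd) + ↑(G.map fun p => Fm.box p.1 p.2)) 0 := by
        refine gseq_struct d ?_ ?_ ?_ ?_
        · intro x hx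
          have := h3 x hx
          simp only [Multiset.mem_add, Multiset.mem_coe]; tauto
        · intro x hx; exact (b' x hx).elim
        · intro x hx
          simp only [Multiset.mem_add, Multiset.mem_coe, List.mem_map] at hx
          rcases hx with (hx | ⟨p, hp, rfl⟩) | ⟨p, hp, rfl⟩
          · exact Linf_box_inner (hS x hx)
          · exact Linf_box_inner (hG p hp)
          · exact hG p hp
        · intro x hx
          simp at hx
      refine world_cons w ?_ ?_
        (GSeq.boxDR hs n S G (fun p hp => (h2 p hp).1) hS hG d')
      · intro x hx
        simp only [Multiset.mem_add, Multiset.mem_coe, List.mem_map] at hx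
        rcases hx with ⟨σ, hσ, rfl⟩ | ⟨p, hp, rfl⟩
        · exact h1 σ hσ
        · exact (h2 p hp).2
      · intro x hx
        simp at hx)
  exact ⟨v, ⟨fun B hB => hv ⟨rfl, Or.inl hB⟩, fun m B hm hB =>
    ⟨hv ⟨rfl, Or.inr ⟨m, B, hm, hB, Or.inl rfl⟩⟩,
     hv ⟨rfl, Or.inr ⟨m, B, hm, hB, Or.inr rfl⟩⟩⟩⟩⟩

/-- Soundness (including cut) for the canonical model. -/
theorem gseq_sound {c : Bool} {Γ Δ : Multiset Fm} (h : GSeq sys c Γ Δ) :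
    ∀ w : CWorld sys, (∀ x ∈ Γ, forces x w) → ∃ x ∈ Δ, forces x w := by
  have boxes : ∀ (n : ℕ) (S : List Fm) (G : List (ℕ × Fm)) (w v : CWorld sys),
      (∀ p ∈ G, p.1 < n) → CR n w v →
      (∀ x ∈ (↑(S.map (Fm.box n)) + ↑(G.map fun p => Fm.box p.1 p.2) : Multiset Fm),
        forces x w) →
      ∀ x ∈ (↑S + ↑(G.map Prod.snd) + ↑(G.map fun p => Fm.box p.1 p.2) : Multiset Fm),
        forces x v := by
    intro n S G w v hn hwv hw x hx
    simp only [Multiset.mem_add, Multiset.mem_coe, List.mem_map] at hx hw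
    rcases hx with (hx | ⟨p, hp, rfl⟩) | ⟨p, hp, rfl⟩
    · exact hw _ (Or.inl ⟨x, hx, rfl⟩) v hwv
    · exact hw _ (Or.inr ⟨p, hp, rfl⟩) v (CR_mono hwv (hn p hp))
    · exact fun u hu => hw _ (Or.inr ⟨p, hp, rfl⟩) u (CR_trans hwv (hn p hp) hu)
  induction h with
  | id A hA => intro w; simp
  | botL => intro w; simp [forces]
  | wL A hA _ ih => intro w; have := ih w; simp_all
  | wR A hA _ ih => intro w; have := ih w; simp only [Multiset.mem_cons] at *; grind
  | cL A _ ih => intro w; have := ih w; simp_all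
  | cR A _ ih => intro w; have := ih w; simp_all
  | cut A _ _ _ ih1 ih2 =>
    intro w; have := ih1 w; have := ih2 w
    simp only [Multiset.mem_cons, Multiset.mem_add] at *; grind
  | orL A B _ _ ih1 ih2 =>
    intro w; have e : forces (A.or B) w ↔ forces A w ∨ forces B w := Iff.rfl
    have := ih1 w; have := ih2 w
    simp only [Multiset.mem_cons, Multiset.mem_add] at *; grind
  | orR₁ A B hB _ ih =>
    intro w; have e : forces (A.or B) w ↔ forces A w ∨ forces B w := Iff.rfl
    have := ih w; simp only [Multiset.mem_cons] at *; grind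
  | orR₂ A B hB _ ih =>
    intro w; have e : forces (A.or B) w ↔ forces A w ∨ forces B w := Iff.rfl
    have := ih w; simp only [Multiset.mem_cons] at *; grind
  | andL₁ A B hB _ ih =>
    intro w; have e : forces (A.and B) w ↔ forces A w ∧ forces B w := Iff.rfl
    have := ih w; simp only [Multiset.mem_cons] at *; grind
  | andL₂ A B hB _ ih =>
    intro w; have e : forces (A.and B) w ↔ forces A w ∧ forces B w := Iff.rfl
    have := ih w; simp only [Multiset.mem_cons] at *; grind
  | andR A B _ _ ih1 ih2 =>
    intro w; have e : forces (A.and B) w ↔ forces A w ∧ forces B w := Iff.rfl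
    have := ih1 w; have := ih2 w
    simp only [Multiset.mem_cons, Multiset.mem_add] at *; grind
  | impL A B _ _ ih1 ih2 =>
    intro w; have e : forces (A.imp B) w ↔ (forces A w → forces B w) := Iff.rfl
    have := ih1 w; have := ih2 w
    simp only [Multiset.mem_cons, Multiset.mem_add] at *; grind
  | impR A B _ ih =>
    intro w; have e : forces (A.imp B) w ↔ (forces A w → forces B w) := Iff.rfl
    have := ih w; simp only [Multiset.mem_cons] at *; grind
  | negL A _ ih =>
    intro w; have e : forces (A.neg) w ↔ ¬ forces A w := Iff.rfl
    have := ih w; simp only [Multiset.mem_cons] at *; grind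
  | negR A _ ih =>
    intro w; have e : forces (A.neg) w ↔ ¬ forces A w := Iff.rfl
    have := ih w; simp only [Multiset.mem_cons] at *; grind
  | box4R hs n S G A hn hS hG hA _ ih =>
    intro w hw
    refine ⟨_, Multiset.mem_singleton_self _, fun v hv => ?_⟩
    obtain ⟨x, hx, hf⟩ := ih v (boxes n S G w v hn hv hw)
    rw [Multiset.mem_singleton] at hx
    exact hx ▸ hf
  | boxDR hs n S G hn hS hG _ ih =>
    intro w hw
    obtain ⟨v, hv⟩ := CR_serial hs n w
    obtain ⟨x, hx, hf⟩ := ih v (boxes n S G w v hn hv hw)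
    simp at hx
  | boxSR hs n S G A hn hS hG hA _ ih =>
    intro w hw
    refine ⟨_, Multiset.mem_singleton_self _, fun v hv => ?_⟩
    obtain ⟨x, hx, hf⟩ := ih v (fun x hx => boxes n S G w v hn hv hw x (by
      simp only [Multiset.mem_add] at hx ⊢; tauto))
    rw [Multiset.mem_singleton] at hx
    exact hx ▸ hf
  | boxL hs n A hA _ ih =>
    intro w hw
    refine ih w fun x hx => ?_
    simp only [Multiset.mem_cons] at hx hw
    rcases hx with rfl | hx
    · exact hw _ (Or.inl rfl) w (CR_refl hs n w)
    · exact hw x (Or.inr hx)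

theorem truth (A : Fm) : ∀ w : CWorld sys,
    (inL w A → forces A w) ∧ (inR w A → ¬ forces A w) := by
  have close : ∀ (w : CWorld sys) {Γ Δ : Multiset Fm}, GSeq sys false Γ Δ →
      ¬ ((∀ x ∈ Γ, inL w x) ∧ (∀ x ∈ Δ, inR w x)) :=
    fun w _ _ h hh => world_cons w hh.1 hh.2 h
  induction A with
  | atom k =>
    intro w
    refine ⟨id, fun h h' => close w (GSeq.id _ (inL_linf h')) ?_⟩
    simp only [Multiset.mem_singleton]
    exact ⟨fun x hx => hx ▸ h', fun x hx => hx ▸ h⟩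
  | bot =>
    intro w
    refine ⟨fun h => close w GSeq.botL ?_, fun _ h => h⟩
    simpa using h
  | and A B ihA ihB =>
    intro w
    constructor
    · intro h
      cases inL_linf h with | and lA lB =>
      constructor
      · refine (ihA w).1 (by_contra fun hc => ?_)
        obtain ⟨Γ, Δ, a, b, d⟩ := not_inL lA hc
        exact close w (GSeq.andL₁ A B lB d) (by simp only [Multiset.mem_cons]; grind)
      · refine (ihB w).1 (by_contra fun hc => ?_)
        obtain ⟨Γ, Δ, a, b, d⟩ := not_inL lB hc
        exact close w (GSeq.andL₂ A B lA d) (by simp only [Multiset.mem_cons]; grind)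
    · intro h hf
      cases inR_linf h with | and lA lB =>
      obtain ⟨Γ, Δ, a, b, d⟩ := not_inR lA (fun hc => (ihA w).2 hc hf.1)
      obtain ⟨Γ', Δ', a', b', d'⟩ := not_inR lB (fun hc => (ihB w).2 hc hf.2)
      exact close w (GSeq.andR A B d d')
        (by simp only [Multiset.mem_cons, Multiset.mem_add]; grind)
  | or A B ihA ihB =>
    intro w
    constructor
    · intro h
      cases inL_linf h with | or lA lB =>
      by_contra hf
      obtain ⟨Γ, Δ, a, b, d⟩ := not_inL lA (fun hc => hf (Or.inl ((ihA w).1 hc)))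
      obtain ⟨Γ', Δ', a', b', d'⟩ := not_inL lB (fun hc => hf (Or.inr ((ihB w).1 hc)))
      exact close w (GSeq.orL A B d d')
        (by simp only [Multiset.mem_cons, Multiset.mem_add]; grind)
    · intro h hf
      cases inR_linf h with | or lA lB =>
      rcases hf with hf | hf
      · obtain ⟨Γ, Δ, a, b, d⟩ := not_inR lA (fun hc => (ihA w).2 hc hf)
        exact close w (GSeq.orR₁ A B lB d) (by simp only [Multiset.mem_cons]; grind)
      · obtain ⟨Γ, Δ, a, b, d⟩ := not_inR lB (fun hc => (ihB w).2 hc hf)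
        exact close w (GSeq.orR₂ A B lA d) (by simp only [Multiset.mem_cons]; grind)
  | imp A B ihA ihB =>
    intro w
    constructor
    · intro h hA
      cases inL_linf h with | imp lA lB =>
      by_contra hf
      obtain ⟨Γ, Δ, a, b, d⟩ := not_inR lA (fun hc => (ihA w).2 hc hA)
      obtain ⟨Γ', Δ', a', b', d'⟩ := not_inL lB (fun hc => hf ((ihB w).1 hc))
      exact close w (GSeq.impL A B d d')
        (by simp only [Multiset.mem_cons, Multiset.mem_add]; grind)
    · intro h hf
      cases inR_linf h with | imp lA lB =>
      by_cases hA : inL w A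
      · obtain ⟨Γ, Δ, a, b, d⟩ := not_inR lB (fun hc => (ihB w).2 hc (hf ((ihA w).1 hA)))
        exact close w (GSeq.impR A B (GSeq.wL A lA d)) (by simp only [Multiset.mem_cons]; grind)
      · obtain ⟨Γ, Δ, a, b, d⟩ := not_inL lA hA
        exact close w (GSeq.impR A B (GSeq.wR B lB d)) (by simp only [Multiset.mem_cons]; grind)
  | neg A ihA =>
    intro w
    constructor
    · intro h hf
      cases inL_linf h with | neg lA =>
      obtain ⟨Γ, Δ, a, b, d⟩ := not_inR lA (fun hc => (ihA w).2 hc hf)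
      exact close w (GSeq.negL A d) (by simp only [Multiset.mem_cons]; grind)
    · intro h hf
      cases inR_linf h with | neg lA =>
      obtain ⟨Γ, Δ, a, b, d⟩ := not_inL lA (fun hc => hf ((ihA w).1 hc))
      exact close w (GSeq.negR A d) (by simp only [Multiset.mem_cons]; grind)
  | box n A ihA =>
    intro w
    constructor
    · intro h v hv
      exact (ihA v).1 (hv.1 A h)
    · intro h hf
      obtain ⟨v, hv, hA⟩ := box_witness h
      exact (ihA v).2 hA (hf v hv)

end CutElimProof

/-- cut elimination for `G(K4_h)`, `G(KD4_h)` and `G(S4_h)`. -/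
theorem cut_elimination (sys : Sys) (Γ Δ : Multiset Fm)
    (h : GSeq sys true Γ Δ) : GSeq sys false Γ Δ := by
  obtain ⟨l1, l2⟩ := gseq_linf h
  by_contra hc
  obtain ⟨w, hw⟩ := world_exists (sys := sys)
    {p | (p.1 = true ∧ p.2 ∈ Γ) ∨ (p.1 = false ∧ p.2 ∈ Δ)} (by
      rintro p (⟨_, hp⟩ | ⟨_, hp⟩)
      · exact l1 _ hp
      · exact l2 _ hp) (by
      rintro ⟨Γ', Δ', a, b, d⟩
      refine hc (gseq_struct d ?_ ?_ l1 l2)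
      · intro x hx
        simpa using a x hx
      · intro x hx
        simpa using b x hx)
  obtain ⟨x, hx, hf⟩ := gseq_sound h w fun x hx => (truth x w).1 (hw (Or.inl ⟨rfl, hx⟩))
  exact (truth x w).2 (hw (Or.inr ⟨rfl, hx⟩)) hf
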